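/- For every ε > 0 there exists a finite constant C such that for all integers h ≥ 1, k ≥ 0 and p ≥ 0, if either k lies in the interval [(h − h^{1/2+ε})/2, (h + h^{1/2+ε})/2] or p ≥ 1, and the chain Y starts at k, then P(A_{h,p}) ≤ (C·h^{−1/2+ε})^{p+1}. -/

import Mathlib

open MeasureTheory ProbabilityTheory
open scoped ENNReal

/-- π(0,j) := δ_{0,j} and, for i > 0, π(i,j) := 2^{−i−j}·(i+j−1)!/((i−1)!·j!). -/
noncomputable def piGW (i j : ℕ) : ℝ :=
  if i = 0 then (if j = 0 then 1 else 0)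
  else (2 : ℝ) ^ (-(i : ℝ) - (j : ℝ)) * (Nat.factorial (i + j - 1)) /
    ((Nat.factorial (i - 1)) * (Nat.factorial j))

/-- `Y` is a Markov chain with transition probabilities `trans` started at `k`:
`P(Y_0 = k) = 1` and
`P(Y_0 = k_0, …, Y_n = k_n) = P(Y_0 = k_0) · ∏_{0 ≤ i < n} trans(k_i, k_{i+1})`. -/
def IsMarkovChainFrom {Ω : Type*} [MeasurableSpace Ω] (P : Measure Ω)
    (Y : ℕ → Ω → ℕ) (trans : ℕ → ℕ → ℝ) (k : ℕ) : Prop :=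
  (∀ t, Measurable (Y t)) ∧
    ∀ (n : ℕ) (ks : ℕ → ℕ),
      P {ω | ∀ i ≤ n, Y i ω = ks i} =
        ENNReal.ofReal ((if ks 0 = k then 1 else 0) *
          ∏ i ∈ Finset.range n, trans (ks i) (ks (i + 1)))

/-- `Ỹ_t := Y_t + Y_{t−1}`. -/
def Ytil {Ω : Type*} (Y : ℕ → Ω → ℕ) (t : ℕ) (ω : Ω) : ℕ :=
  Y t ω + Y (t - 1) ω

/-- `σ̃_h := inf{t ≥ 1 : Ỹ_t ≥ h}` (with value `∞` if there is no such `t`). -/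
noncomputable def sigmaTil {Ω : Type*} (Y : ℕ → Ω → ℕ) (h : ℕ) (ω : Ω) : ℕ∞ :=
  sInf ((↑) '' {t : ℕ | 1 ≤ t ∧ h ≤ Ytil Y t ω} : Set ℕ∞)

/-- The event `A_{h,p}`: for `p = 0` it is `{σ̃_h = ∞}`; for `p ≥ 1` it is
`{sup{Ỹ_t : t ≥ 1} = h and #{t ≥ 1 : Ỹ_t = h} = p}`. -/
noncomputable def eventA {Ω : Type*} (Y : ℕ → Ω → ℕ) (h p : ℕ) : Set Ω :=
  if p = 0 then {ω | sigmaTil Y h ω = ⊤}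
  else {ω | (∀ t, 1 ≤ t → Ytil Y t ω ≤ h) ∧
        {t : ℕ | 1 ≤ t ∧ Ytil Y t ω = h}.encard = (p : ℕ∞)}

/-! ### The transition kernel -/

lemma piGW_zero_left (m : ℕ) : piGW 0 m = if m = 0 then 1 else 0 := by
  simp [piGW]

lemma piGW_succ_left (i m : ℕ) :
    piGW (i + 1) m = (2 ^ (i + 1))⁻¹ * (((m + i).choose i : ℝ) * (1 / 2) ^ m) := by
  have h1 : (2 : ℝ) ^ (-((i + 1 : ℕ) : ℝ) - (m : ℝ)) = (2 ^ (i + 1))⁻¹ * (1 / 2) ^ m := by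
    rw [Real.rpow_sub two_pos, Real.rpow_neg two_pos.le, Real.rpow_natCast, Real.rpow_natCast,
      one_div, inv_pow, div_eq_mul_inv]
  have h2 : ((m + i).choose i : ℝ) =
      (Nat.factorial (m + i) : ℝ) / (Nat.factorial i * Nat.factorial m) := by
    rw [Nat.cast_choose ℝ (Nat.le_add_left i m), Nat.add_sub_cancel]
  have h3 : i + 1 + m - 1 = m + i := by omega
  simp only [piGW, if_neg (Nat.succ_ne_zero i), h1, h2, h3, Nat.add_sub_cancel]
  ring

lemma piGW_nonneg (j m : ℕ) : 0 ≤ piGW j m := by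
  cases j with
  | zero => rw [piGW_zero_left]; split_ifs <;> norm_num
  | succ i => rw [piGW_succ_left]; positivity

/-- The generating function of the offspring of `j` individuals. -/
lemma hasSum_piGW_mul_pow (j : ℕ) {z : ℝ} (hz : |z| < 2) :
    HasSum (fun m => piGW j m * z ^ m) (((2 - z) ^ j)⁻¹) := by
  cases j with
  | zero =>
    rw [pow_zero, inv_one]
    refine (hasSum_ite_eq (0 : ℕ) (1 : ℝ)).congr_fun fun m => ?_
    rw [piGW_zero_left]
    split_ifs with hm <;> simp [hm]
  | succ i =>
    have hr : ‖z / 2‖ < 1 := by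
      rw [Real.norm_eq_abs, abs_div, abs_two]; linarith
    have h := (hasSum_choose_mul_geometric_of_norm_lt_one i hr).mul_left (((2 : ℝ) ^ (i + 1))⁻¹)
    have e : (2 ^ (i + 1))⁻¹ * (1 / (1 - z / 2) ^ (i + 1)) = ((2 - z) ^ (i + 1))⁻¹ := by
      rw [one_div, ← mul_inv, ← mul_pow]
      congr 2
      ring
    rw [e] at h
    refine h.congr_fun fun m => ?_
    rw [piGW_succ_left, one_div, inv_pow, div_pow]
    ring

lemma hasSum_piGW (j : ℕ) : HasSum (piGW j) 1 := by
  have h := hasSum_piGW_mul_pow j (z := 1) (by norm_num)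
  norm_num at h
  exact h

/-- The offspring mean is one. -/
lemma hasSum_piGW_mul_self (j : ℕ) : HasSum (fun m => piGW j m * m) j := by
  cases j with
  | zero =>
    rw [Nat.cast_zero]
    refine hasSum_zero.congr_fun fun m => ?_
    rw [piGW_zero_left]
    split_ifs with hm <;> simp [hm]
  | succ i =>
    rw [← hasSum_nat_add_iff' 1]
    have h := (hasSum_piGW (i + 2)).mul_left ((i + 1 : ℕ) : ℝ)
    simp only [Finset.range_one, Finset.sum_singleton, Nat.cast_zero, mul_zero, sub_zero]
    rw [mul_one] at h
    refine h.congr_fun fun m => ?_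
    rw [piGW_succ_left, piGW_succ_left]
    have h1 : ((m + 1 + i).choose i : ℝ) * (m + 1 : ℕ) =
        ((m + (i + 1)).choose (i + 1) : ℝ) * (i + 1 : ℕ) := by
      have := Nat.choose_succ_right_eq (m + (i + 1)) i
      have e : m + (i + 1) - i = m + 1 := by omega
      rw [e] at this
      rw [show m + 1 + i = m + (i + 1) by ring]
      exact_mod_cast this.symm
    calc _ = (2 ^ (i + 1))⁻¹ * (1 / 2 : ℝ) ^ (m + 1) *
          (((m + 1 + i).choose i : ℝ) * (m + 1 : ℕ)) := by ring
      _ = _ := by rw [h1]; ring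

/-- Exponential moments of the centred offspring number. -/
lemma exists_hasSum_piGW_mul_exp (j : ℕ) {l : ℝ} (hl : 8 * l ^ 2 ≤ 1) :
    ∃ S, HasSum (fun m : ℕ => piGW j m * Real.exp (l * (m - j))) S ∧
      S ≤ Real.exp (8 * l ^ 2 * j) := by
  have hl1 : |l| ≤ 1 := abs_le_one_iff_mul_self_le_one.mpr (by nlinarith)
  have hl2 : |l| < 1 / 2 := by
    apply abs_lt_of_sq_lt_sq _ (by norm_num)
    nlinarith
  have h1 : |Real.exp l - 1| ≤ 2 * |l| := Real.abs_exp_sub_one_le hl1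
  have h2 : (Real.exp l - 1) ^ 2 ≤ 4 * l ^ 2 := by
    rw [← sq_abs (Real.exp l - 1), ← sq_abs l]
    nlinarith [abs_nonneg (Real.exp l - 1)]
  have hz : |Real.exp l| < 2 := by
    rw [abs_of_pos (Real.exp_pos l)]
    have := (abs_le.mp h1).2
    linarith
  have hE := (hasSum_piGW_mul_pow j hz).mul_right (Real.exp (-l * j))
  refine ⟨_, hE.congr_fun fun m => ?_, ?_⟩
  · rw [mul_assoc, ← Real.exp_nat_mul, ← Real.exp_add]
    congr 2
    ring
  · have h3 : Real.exp (-(8 * l ^ 2)) ≤ Real.exp l * (2 - Real.exp l) := by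
      have h4 : Real.exp l * (2 - Real.exp l) = 1 - (Real.exp l - 1) ^ 2 := by ring
      rw [h4, Real.exp_neg]
      have h5 : 1 + 8 * l ^ 2 ≤ Real.exp (8 * l ^ 2) := by
        linarith [Real.add_one_le_exp (8 * l ^ 2)]
      rw [inv_le_iff_one_le_mul₀ (Real.exp_pos _)]
      have h6 : 1 ≤ (1 - 4 * l ^ 2) * (1 + 8 * l ^ 2) := by nlinarith [sq_nonneg l]
      refine h6.trans (mul_le_mul ?_ h5 (by positivity) ?_) <;> nlinarith
    have h7 := pow_le_pow_left₀ (Real.exp_pos _).le h3 j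
    rw [← Real.exp_nat_mul] at h7
    have h8 : ((2 - Real.exp l) ^ j)⁻¹ * Real.exp (-l * j) =
        ((Real.exp l * (2 - Real.exp l)) ^ j)⁻¹ := by
      rw [mul_pow, mul_inv, mul_comm, ← Real.exp_nat_mul, ← Real.exp_neg]
      congr 2
      ring
    rw [h8]
    calc _ ≤ (Real.exp (j * -(8 * l ^ 2)))⁻¹ := inv_anti₀ (Real.exp_pos _) h7
      _ = _ := by rw [← Real.exp_neg]; congr 1; ring

/-! ### First-step analysis -/

/-- Along the first `n` steps of the path `y`, the sums of consecutive values stay at most `h` and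
equal `h` exactly `p` times. -/
def PathHits (h : ℕ) : ℕ → ℕ → (ℕ → ℕ) → Prop
  | 0, p, _ => p = 0
  | n + 1, p, y =>
    (y 0 + y 1 < h ∧ PathHits h n p fun t => y (t + 1)) ∨
      (y 0 + y 1 = h ∧ ∃ q, p = q + 1 ∧ PathHits h n q fun t => y (t + 1))

lemma pathHits_count (h n : ℕ) (y : ℕ → ℕ) (hy : ∀ t, y t + y (t + 1) ≤ h) :
    PathHits h n (Nat.count (fun t => y t + y (t + 1) = h) n) y := by
  induction n generalizing y with
  | zero => simp [PathHits]
  | succ n ih =>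
    have := ih (fun t => y (t + 1)) (fun t => hy (t + 1))
    rw [Nat.count_succ']
    rcases (hy 0).lt_or_eq with h0 | h0
    · left
      refine ⟨h0, ?_⟩
      rw [if_neg h0.ne]
      exact this
    · right
      refine ⟨h0, _, ?_, this⟩
      rw [if_pos h0]

lemma eventA_subset {Ω : Type} (Y : ℕ → Ω → ℕ) {h : ℕ} (p : ℕ) :
    eventA Y h p ⊆ {ω | ∀ᶠ n in Filter.atTop, PathHits h n p fun t => Y t ω} := by
  intro ω hω
  have key : (∀ t, 1 ≤ t → Ytil Y t ω ≤ h) ∧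
      {t : ℕ | 1 ≤ t ∧ Ytil Y t ω = h}.encard = (p : ℕ∞) := by
    unfold eventA at hω
    split_ifs at hω with hp
    · have hlt : ∀ t, 1 ≤ t → Ytil Y t ω < h := by
        intro t ht
        by_contra hle
        have hmem : ((t : ℕ) : ℕ∞) ∈
            ((↑) '' {t : ℕ | 1 ≤ t ∧ h ≤ Ytil Y t ω} : Set ℕ∞) :=
          ⟨t, ⟨ht, not_lt.mp hle⟩, rfl⟩
        have := sInf_le hmem
        rw [Set.mem_ofPred_eq, sigmaTil] at hω
        rw [hω] at this
        exact ENat.natCast_ne_top t (top_le_iff.mp this)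
      refine ⟨fun t ht => (hlt t ht).le, ?_⟩
      rw [hp, Nat.cast_zero, Set.encard_eq_zero, Set.eq_empty_iff_forall_notMem]
      exact fun t ht => (hlt t ht.1).ne ht.2
    · exact hω
  obtain ⟨hle, hcard⟩ := key
  have hy : ∀ t, Y t ω + Y (t + 1) ω ≤ h := fun t => by
    have := hle (t + 1) (by omega)
    simp only [Ytil, Nat.add_sub_cancel] at this
    omega
  have himg : {t : ℕ | 1 ≤ t ∧ Ytil Y t ω = h} =
      Nat.succ '' {t : ℕ | Y t ω + Y (t + 1) ω = h} := by
    ext t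
    constructor
    · rintro ⟨h1, h2⟩
      obtain ⟨s, rfl⟩ := Nat.exists_eq_add_of_le' h1
      refine ⟨s, ?_, rfl⟩
      simp only [Ytil, Nat.add_sub_cancel] at h2
      rw [Set.mem_ofPred_eq]
      omega
    · rintro ⟨s, h2, rfl⟩
      rw [Set.mem_ofPred_eq] at h2
      refine ⟨by omega, ?_⟩
      simp only [Ytil, Nat.succ_eq_add_one, Nat.add_sub_cancel]
      omega
  rw [himg, Nat.succ_injective.encard_image] at hcard
  have hfin : {t : ℕ | Y t ω + Y (t + 1) ω = h}.Finite :=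
    Set.finite_of_encard_eq_coe hcard
  obtain ⟨N, hN⟩ := hfin.bddAbove
  filter_upwards [Filter.eventually_gt_atTop N] with n hn
  have hcount : Nat.count (fun t => Y t ω + Y (t + 1) ω = h) n = p := by
    rw [Nat.count_eq_card_filter_range]
    have : (({x ∈ Finset.range n | Y x ω + Y (x + 1) ω = h} : Finset ℕ) : Set ℕ) =
        {t : ℕ | Y t ω + Y (t + 1) ω = h} := by
      ext t
      simp only [Finset.coe_filter, Finset.mem_range, Set.mem_ofPred_eq, and_iff_right_iff_imp]
      exact fun ht => (hN ht).trans_lt hn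
    rw [← this, Set.encard_coe_eq_coe_finsetCard] at hcard
    exact_mod_cast hcard
  rw [← hcount]
  exact pathHits_count h n (fun t => Y t ω) hy

section Chain

variable {Ω : Type} [MeasurableSpace Ω] {P : Measure Ω} {Y : ℕ → Ω → ℕ} {k : ℕ}

lemma IsMarkovChainFrom.ae_zero [IsProbabilityMeasure P] (hY : IsMarkovChainFrom P Y piGW k) :
    ∀ᵐ ω ∂P, Y 0 ω = k := by
  have h := hY.2 0 fun _ => k
  simp only [Nat.le_zero, forall_eq, if_true, Finset.range_zero, Finset.prod_empty, mul_one,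
    ENNReal.ofReal_one] at h
  exact (prob_compl_eq_zero_iff ((hY.1 0) (measurableSet_singleton k))).mpr h

lemma IsMarkovChainFrom.measure_cons [IsProbabilityMeasure P] (hY : IsMarkovChainFrom P Y piGW k)
    (n : ℕ) (ks : ℕ → ℕ) :
    P {ω | ∀ i ≤ n, Y (i + 1) ω = ks i} =
      ENNReal.ofReal (piGW k (ks 0) * ∏ i ∈ Finset.range n, piGW (ks i) (ks (i + 1))) := by
  have h := hY.2 (n + 1) fun i => Nat.casesOn i k ks
  rw [Finset.prod_range_succ'] at h
  change P {ω | ∀ i ≤ n + 1, Y i ω = (Nat.casesOn i k ks : ℕ)} =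
    ENNReal.ofReal ((if k = k then 1 else 0) *
      ((∏ i ∈ Finset.range n, piGW (ks i) (ks (i + 1))) * piGW k (ks 0))) at h
  rw [if_pos rfl, one_mul] at h
  rw [mul_comm, ← h]
  apply measure_congr
  filter_upwards [hY.ae_zero] with ω hω
  apply propext
  constructor
  · intro H i hi
    cases i with
    | zero => exact hω
    | succ i => exact H i (by omega)
  · intro H i hi
    exact H (i + 1) (by omega)

lemma IsMarkovChainFrom.measure_one [IsProbabilityMeasure P] (hY : IsMarkovChainFrom P Y piGW k)
    (m : ℕ) : P {ω | Y 1 ω = m} = ENNReal.ofReal (piGW k m) := by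
  have h := hY.measure_cons 0 fun _ => m
  simpa using h

/-- The Markov property at time one. -/
lemma IsMarkovChainFrom.cond_one [IsProbabilityMeasure P] (hY : IsMarkovChainFrom P Y piGW k)
    {m : ℕ} (hm : P {ω | Y 1 ω = m} ≠ 0) :
    IsMarkovChainFrom (P[|{ω | Y 1 ω = m}]) (fun t => Y (t + 1)) piGW m := by
  refine ⟨fun t => hY.1 (t + 1), fun n ks => ?_⟩
  have hmeas : MeasurableSet {ω | Y 1 ω = m} := hY.1 1 (measurableSet_singleton m)
  rw [cond_apply hmeas]
  split_ifs with h0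
  · have hsub : {ω | Y 1 ω = m} ∩ {ω | ∀ i ≤ n, Y (i + 1) ω = ks i} =
        {ω | ∀ i ≤ n, Y (i + 1) ω = ks i} := by
      apply Set.inter_eq_right.mpr
      intro ω hω
      have := hω 0 (Nat.zero_le n)
      rw [Set.mem_ofPred_eq, ← h0, ← this]
    rw [hsub, hY.measure_cons, h0, one_mul, ENNReal.ofReal_mul (piGW_nonneg k m), ← mul_assoc,
      hY.measure_one, ENNReal.inv_mul_cancel, one_mul]
    · rwa [← hY.measure_one]
    · exact ENNReal.ofReal_ne_top
  · have hsub : {ω | Y 1 ω = m} ∩ {ω | ∀ i ≤ n, Y (i + 1) ω = ks i} = ∅ := by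
      rw [Set.eq_empty_iff_forall_notMem]
      rintro ω ⟨h1, h2⟩
      exact h0 ((h2 0 (Nat.zero_le n)).symm.trans h1)
    rw [hsub]
    simp

end Chain

/-- The probability of `p` hits of `h` without exceeding `h` is at most `W k` for the chain
started at `k`, up to the probability of not having been absorbed. -/
def HitBound (h p : ℕ) (W : ℕ → ℝ) : Prop :=
  ∀ (n k : ℕ) (Ω : Type) (_ : MeasurableSpace Ω) (P : Measure Ω) (Y : ℕ → Ω → ℕ),
    IsProbabilityMeasure P → IsMarkovChainFrom P Y piGW k →
      P {ω | PathHits h n p fun t => Y t ω} ≤ ENNReal.ofReal (W k + (1 - ((n : ℝ) / (n + 1)) ^ k))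

lemma HitBound.mono {h p : ℕ} {W W' : ℕ → ℝ} (hW : HitBound h p W) (hle : ∀ k, W k ≤ W' k) :
    HitBound h p W' := fun n k Ω _ P Y hP hY =>
  (hW n k Ω _ P Y hP hY).trans (ENNReal.ofReal_le_ofReal (by linarith [hle k]))

lemma HitBound.measure_eventA_le {h p : ℕ} {W : ℕ → ℝ} (hW : HitBound h p W) {k : ℕ}
    {Ω : Type} [MeasurableSpace Ω] {P : Measure Ω} [IsProbabilityMeasure P] {Y : ℕ → Ω → ℕ}
    (hY : IsMarkovChainFrom P Y piGW k) :
    P (eventA Y h p) ≤ ENNReal.ofReal (W k) := by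
  set D : ℕ → Set Ω := fun N => {ω | ∀ n ≥ N, PathHits h n p fun t => Y t ω} with hD
  have hmono : Monotone D := fun N M hNM ω hω n hn => hω n (hNM.trans hn)
  have hsub : eventA Y h p ⊆ ⋃ N, D N := by
    refine (eventA_subset Y p).trans fun ω hω => ?_
    obtain ⟨N, hN⟩ := Filter.eventually_atTop.mp hω
    exact Set.mem_iUnion.mpr ⟨N, hN⟩
  refine (measure_mono hsub).trans ?_
  rw [hmono.measure_iUnion]
  refine iSup_le fun N => ?_
  have hlim : Filter.Tendsto
      (fun n : ℕ => ENNReal.ofReal (W k + (1 - ((n : ℝ) / (n + 1)) ^ k))) Filter.atTop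
      (nhds (ENNReal.ofReal (W k))) := by
    apply ENNReal.tendsto_ofReal
    have h1 : Filter.Tendsto (fun n : ℕ => (n : ℝ) / (n + 1)) Filter.atTop (nhds 1) :=
      tendsto_natCast_div_add_atTop 1
    have h2 := ((h1.pow k).const_sub 1).const_add (W k)
    simpa using h2
  refine ge_of_tendsto hlim ?_
  filter_upwards [Filter.eventually_ge_atTop N] with n hn
  have hDn : D N ⊆ {ω | PathHits h n p fun t => Y t ω} := fun ω hω => hω n hn
  exact (measure_mono hDn).trans (hW n k Ω _ P Y inferInstance hY)

/-- A nonnegative supersolution of the first-step equation bounds the hitting probabilities. -/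
lemma hitBound_of_supersolution {h p : ℕ} {V W : ℕ → ℝ} (hV : ∀ k, 0 ≤ V k) (hW : ∀ k, 0 ≤ W k)
    (hprev : ∀ q, p = q + 1 → HitBound h q V) (hzero : p = 0 → 1 ≤ W 0)
    (hstep : ∀ k ≤ h, ∑ m ∈ Finset.range (h - k), piGW k m * W m + piGW k (h - k) * V (h - k) ≤
      W k) : HitBound h p W := by
  intro n
  induction n with
  | zero =>
    intro k Ω _ P Y hP hY
    by_cases hp : p = 0
    · refine prob_le_one.trans ?_
      rw [← ENNReal.ofReal_one]
      apply ENNReal.ofReal_le_ofReal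
      cases k with
      | zero => simpa using hzero hp
      | succ k => simpa using hW (k + 1)
    · simp [PathHits, hp]
  | succ n ih =>
    intro k Ω _ P Y hP hY
    set r : ℝ := (n : ℝ) / (n + 1) with hr
    have hr0 : 0 ≤ r := by positivity
    have hr1 : r ≤ 1 := by
      rw [hr, div_le_one (by positivity)]
      linarith
    have hrpow : ∀ m : ℕ, 0 ≤ 1 - r ^ m := fun m => by
      linarith [pow_le_one₀ hr0 hr1 (n := m)]
    set G : ℕ → ℝ := fun m => if k + m < h then W m else if k + m = h then V m else 0 with hG
    have hG0 : ∀ m, 0 ≤ G m := fun m => by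
      simp only [hG]
      split_ifs
      exacts [hW m, hV m, le_rfl]
    have hterm : ∀ m, P ({ω | PathHits h (n + 1) p fun t => Y t ω} ∩ {ω | Y 1 ω = m}) ≤
        ENNReal.ofReal (piGW k m * (G m + (1 - r ^ m))) := by
      intro m
      by_cases hm : P {ω | Y 1 ω = m} = 0
      · exact (measure_mono Set.inter_subset_right).trans (hm.le.trans zero_le)
      have hmeas : MeasurableSet {ω | Y 1 ω = m} := hY.1 1 (measurableSet_singleton m)
      have hchain := hY.cond_one hm
      have hprob : IsProbabilityMeasure (P[|{ω | Y 1 ω = m}]) := cond_isProbabilityMeasure hm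
      have hbound : ∀ (q : ℕ) (B : ℝ),
          (P[|{ω | Y 1 ω = m}]) {ω | PathHits h n q fun t => Y (t + 1) ω} ≤ ENNReal.ofReal B →
          P ({ω | PathHits h n q fun t => Y (t + 1) ω} ∩ {ω | Y 1 ω = m}) ≤
            ENNReal.ofReal (piGW k m * B) := by
        intro q B hB
        rw [Set.inter_comm, ← cond_mul_eq_inter hmeas, hY.measure_one, mul_comm,
          ENNReal.ofReal_mul (piGW_nonneg k m)]
        gcongr
      rcases lt_trichotomy (k + m) h with hlt | heq | hgt
      · have hGm : G m = W m := by simp [hG, hlt]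
        rw [hGm]
        refine le_trans (measure_mono_ae ?_) (hbound p _ (ih m Ω _ _ _ hprob hchain))
        filter_upwards [hY.ae_zero] with ω h0
        rintro ⟨h1 | h1, h2⟩
        · exact ⟨h1.2, h2⟩
        · have h3 := h1.1
          beta_reduce at h3
          simp only [Set.mem_ofPred_eq] at h2
          omega
      · have hGm : G m = V m := by simp [hG, heq]
        rw [hGm]
        cases p with
        | zero =>
          refine le_trans (le_of_eq ?_) zero_le
          rw [← nonpos_iff_eq_zero, ← measure_empty (μ := P)]
          apply measure_mono_ae
          filter_upwards [hY.ae_zero] with ω h0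
          rintro ⟨h1 | h1, h2⟩
          · have h3 := h1.1
            beta_reduce at h3
            simp only [Set.mem_ofPred_eq] at h2
            omega
          · obtain ⟨q, hq, -⟩ := h1.2
            omega
        | succ q =>
          refine le_trans (measure_mono_ae ?_)
            (hbound q _ (hprev q rfl n m Ω _ _ _ hprob hchain))
          filter_upwards [hY.ae_zero] with ω h0
          rintro ⟨h1 | h1, h2⟩
          · have h3 := h1.1
            beta_reduce at h3
            simp only [Set.mem_ofPred_eq] at h2
            omega
          · obtain ⟨q', hq, h4⟩ := h1.2
            obtain rfl : q = q' := by omega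
            exact ⟨h4, h2⟩
      · refine le_trans (le_of_eq ?_) zero_le
        rw [← nonpos_iff_eq_zero, ← measure_empty (μ := P)]
        apply measure_mono_ae
        filter_upwards [hY.ae_zero] with ω h0
        rintro ⟨h1 | h1, h2⟩ <;>
        · have h3 := h1.1
          beta_reduce at h3
          simp only [Set.mem_ofPred_eq] at h2
          omega
    have hcover : {ω | PathHits h (n + 1) p fun t => Y t ω} ⊆
        ⋃ m, ({ω | PathHits h (n + 1) p fun t => Y t ω} ∩ {ω | Y 1 ω = m}) :=
      fun ω hω => Set.mem_iUnion.mpr ⟨Y 1 ω, hω, rfl⟩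
    have hr2 : |r| < 2 := by rw [abs_of_nonneg hr0]; linarith
    have hsum1 : HasSum (fun m => piGW k m * (1 - r ^ m)) (1 - ((2 - r) ^ k)⁻¹) :=
      ((hasSum_piGW k).sub (hasSum_piGW_mul_pow k hr2)).congr_fun fun m => by ring
    have hsum2 : HasSum (fun m => piGW k m * G m)
        (∑ m ∈ Finset.range (h - k + 1), piGW k m * G m) := by
      apply hasSum_sum_of_ne_finset_zero
      intro m hm
      rw [Finset.mem_range] at hm
      have h1 : ¬ k + m < h := by omega
      by_cases h2 : k + m = h
      · omega
      · simp [hG, h1, h2]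
    have hsum2_le : ∑ m ∈ Finset.range (h - k + 1), piGW k m * G m ≤ W k := by
      by_cases hk : k ≤ h
      · rw [Finset.sum_range_succ]
        have e : G (h - k) = V (h - k) := by
          have : k + (h - k) = h := by omega
          simp [hG, this]
        rw [e]
        refine le_trans (le_of_eq ?_) (hstep k hk)
        congr 1
        refine Finset.sum_congr rfl fun m hm => ?_
        rw [Finset.mem_range] at hm
        have : k + m < h := by omega
        simp [hG, this]
      · have e : h - k + 1 = 1 := by omega
        have h1 : ¬ k < h := by omega
        have h2 : ¬ k = h := by omega
        rw [e, Finset.sum_range_one]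
        simpa [hG, h1, h2] using hW k
    have hsum : HasSum (fun m => piGW k m * (G m + (1 - r ^ m)))
        (∑ m ∈ Finset.range (h - k + 1), piGW k m * G m + (1 - ((2 - r) ^ k)⁻¹)) :=
      (hsum2.add hsum1).congr_fun fun m => by ring
    have hrk : ((2 - r) ^ k)⁻¹ = (((n + 1 : ℕ) : ℝ) / ((n + 1 : ℕ) + 1)) ^ k := by
      rw [← inv_pow]
      congr 1
      have e : 2 - r = ((n + 1 : ℕ) + 1) / (n + 1 : ℕ) := by
        rw [hr]
        push_cast
        field_simp
        ring
      rw [e, inv_div]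
    calc P {ω | PathHits h (n + 1) p fun t => Y t ω}
        ≤ ∑' m, P ({ω | PathHits h (n + 1) p fun t => Y t ω} ∩ {ω | Y 1 ω = m}) :=
          (measure_mono hcover).trans (measure_iUnion_le _)
      _ ≤ ∑' m, ENNReal.ofReal (piGW k m * (G m + (1 - r ^ m))) := ENNReal.tsum_le_tsum hterm
      _ = ENNReal.ofReal (∑' m, piGW k m * (G m + (1 - r ^ m))) :=
          (ENNReal.ofReal_tsum_of_nonneg (fun m => mul_nonneg (piGW_nonneg k m)
            (add_nonneg (hG0 m) (hrpow m))) hsum.summable).symm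
      _ ≤ _ := by
          rw [hsum.tsum_eq, hrk]
          exact ENNReal.ofReal_le_ofReal (by linarith)

/-! ### Estimates for the transition kernel -/

lemma sum_piGW_le_one (j : ℕ) (s : Finset ℕ) : ∑ m ∈ s, piGW j m ≤ 1 :=
  sum_le_hasSum s (fun m _ => piGW_nonneg j m) (hasSum_piGW j)

/-- A bounded function on which the kernel acts with a drift of at most `-1` on `[1, h]`. -/
noncomputable def driftFun (h : ℕ) (m : ℕ) : ℝ := 3 * (h : ℝ) ^ 2 * (1 - (1 - 1 / (h : ℝ)) ^ m)

section Drift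

variable {h : ℕ} (hh : 2 ≤ h)
include hh

lemma driftFun_base : 0 ≤ 1 - 1 / (h : ℝ) ∧ 1 - 1 / (h : ℝ) ≤ 1 := by
  have h0 : (2 : ℝ) ≤ h := by exact_mod_cast hh
  have h1 : 1 / (h : ℝ) ≤ 1 := by
    rw [div_le_one (by linarith)]
    linarith
  have h2 : 0 ≤ 1 / (h : ℝ) := by positivity
  constructor <;> linarith

lemma driftFun_nonneg (m : ℕ) : 0 ≤ driftFun h m := by
  obtain ⟨h1, h2⟩ := driftFun_base hh
  have := pow_le_one₀ h1 h2 (n := m)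
  exact mul_nonneg (by positivity) (by linarith)

lemma driftFun_le (m : ℕ) : driftFun h m ≤ 3 * (h : ℝ) ^ 2 := by
  obtain ⟨h1, -⟩ := driftFun_base hh
  have := pow_nonneg h1 m
  have h3 : (0 : ℝ) ≤ 3 * (h : ℝ) ^ 2 := by positivity
  unfold driftFun
  nlinarith

lemma sum_piGW_mul_driftFun_le {j : ℕ} (hj : 1 ≤ j) (hjh : j ≤ h) (N : ℕ) :
    ∑ m ∈ Finset.range N, piGW j m * driftFun h m ≤ driftFun h j - 1 := by
  obtain ⟨h1, h2⟩ := driftFun_base hh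
  have h0 : (2 : ℝ) ≤ h := by exact_mod_cast hh
  set x : ℝ := 1 / (h : ℝ) with hx
  have hx0 : 0 < x := by positivity
  have hxh : (h : ℝ) * x = 1 := by rw [hx]; field_simp
  have hsum : HasSum (fun m => piGW j m * driftFun h m)
      (3 * (h : ℝ) ^ 2 * (1 - ((2 - (1 - x)) ^ j)⁻¹)) :=
    (((hasSum_piGW j).sub (hasSum_piGW_mul_pow j (z := 1 - x)
      (by rw [abs_of_nonneg h1]; linarith))).mul_left (3 * (h : ℝ) ^ 2)).congr_fun
      fun m => by rw [driftFun]; ring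
  refine (sum_le_hasSum _ (fun m _ => mul_nonneg (piGW_nonneg j m)
    (driftFun_nonneg hh m)) hsum).trans ?_
  rw [driftFun, ← hx]
  have e : 2 - (1 - x) = 1 + x := by ring
  rw [e]
  have hq : 0 < (1 + x) ^ j := by positivity
  have hq3 : (1 + x) ^ j ≤ 3 := by
    have h4 : (1 + x) ^ j ≤ Real.exp (h * x) := by
      calc (1 + x) ^ j ≤ (1 + x) ^ h := pow_le_pow_right₀ (by linarith) hjh
        _ ≤ Real.exp x ^ h :=
          pow_le_pow_left₀ (by linarith) (by linarith [Real.add_one_le_exp x]) h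
        _ = _ := by rw [← Real.exp_nat_mul]
    rw [hxh] at h4
    linarith [Real.exp_one_lt_d9]
  have hprod : (1 - x) ^ j * (1 + x) ^ j ≤ 1 - x ^ 2 := by
    rw [← mul_pow]
    have e2 : (1 - x) * (1 + x) = 1 - x ^ 2 := by ring
    rw [e2]
    have h5 : 0 ≤ 1 - x ^ 2 := by rw [← e2]; positivity
    calc (1 - x ^ 2) ^ j ≤ (1 - x ^ 2) ^ 1 :=
          pow_le_pow_of_le_one h5 (by linarith [sq_nonneg x]) hj
      _ = _ := pow_one _
  have hkey : x ^ 2 / 3 ≤ ((1 + x) ^ j)⁻¹ - (1 - x) ^ j := by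
    have h6 : (1 - x) ^ j ≤ (1 - x ^ 2) * ((1 + x) ^ j)⁻¹ := by
      rw [← div_eq_mul_inv, le_div_iff₀ hq]
      exact hprod
    have h7 : (3 : ℝ)⁻¹ ≤ ((1 + x) ^ j)⁻¹ := inv_anti₀ hq hq3
    have h8 : x ^ 2 * (3 : ℝ)⁻¹ ≤ x ^ 2 * ((1 + x) ^ j)⁻¹ :=
      mul_le_mul_of_nonneg_left h7 (sq_nonneg x)
    linarith
  have h9 := mul_le_mul_of_nonneg_left hkey (show (0 : ℝ) ≤ 3 * (h : ℝ) ^ 2 by positivity)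
  have h10 : 3 * (h : ℝ) ^ 2 * (x ^ 2 / 3) = 1 := by
    calc _ = ((h : ℝ) * x) ^ 2 := by ring
      _ = 1 := by rw [hxh, one_pow]
  linarith

end Drift

section Tail

variable {h : ℕ} {l : ℝ} (hh : 8 ≤ h) (hlh : l ^ 2 * h = 1)
include hh hlh

lemma exists_hasSum_piGW_mul_exp_le {j : ℕ} (hj : j ≤ h) :
    ∃ S, HasSum (fun m : ℕ => piGW j m * Real.exp (l * (m - j))) S ∧ S ≤ Real.exp 8 := by
  have h0 : (8 : ℝ) ≤ h := by exact_mod_cast hh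
  have hjr : (j : ℝ) ≤ h := by exact_mod_cast hj
  have h1 : 8 * l ^ 2 ≤ 1 := by nlinarith [sq_nonneg l]
  obtain ⟨S, hS, hle⟩ := exists_hasSum_piGW_mul_exp j h1
  refine ⟨S, hS, hle.trans (Real.exp_le_exp.mpr ?_)⟩
  nlinarith [mul_le_mul_of_nonneg_left hjr (sq_nonneg l)]

lemma sum_piGW_mul_exp_le {j : ℕ} (hj : j ≤ h) (s : Finset ℕ) (b : ℝ) :
    ∑ m ∈ s, piGW j m * Real.exp (l * (m - b)) ≤ Real.exp 8 * Real.exp (l * (j - b)) := by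
  obtain ⟨S, hS, hle⟩ := exists_hasSum_piGW_mul_exp_le hh hlh hj
  have h1 : HasSum (fun m : ℕ => piGW j m * Real.exp (l * (m - b)))
      (S * Real.exp (l * (j - b))) := by
    refine (hS.mul_right _).congr_fun fun m => ?_
    rw [mul_assoc, ← Real.exp_add]
    congr 2
    ring
  exact (sum_le_hasSum s (fun m _ => mul_nonneg (piGW_nonneg j m) (Real.exp_pos _).le) h1).trans
    (mul_le_mul_of_nonneg_right hle (Real.exp_pos _).le)

lemma piGW_le_exp {j : ℕ} (hj : j ≤ h) (m : ℕ) :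
    piGW j m ≤ Real.exp 8 * Real.exp (l * (j - m)) := by
  have := sum_piGW_mul_exp_le hh hlh hj {m} m
  simpa using this

lemma sum_piGW_mul_posPart_le {j : ℕ} (hj : j ≤ h) (hl : 0 < l) {a : ℝ} (ha : 0 < a) (N : ℕ) :
    ∑ m ∈ Finset.range N, piGW j m * max (1 - m / a) 0 ≤
      1 - j / a + Real.exp 8 * Real.exp (l * (j - a)) / (l * a) := by
  obtain ⟨S, hS, hle⟩ := exists_hasSum_piGW_mul_exp_le hh hlh hj
  have hla : 0 < l * a := mul_pos hl ha
  have hsum : HasSum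
      (fun m : ℕ => piGW j m * (1 - m / a + Real.exp (l * (m - a)) / (l * a)))
      (1 - j * a⁻¹ + S * (Real.exp (l * (j - a)) / (l * a))) := by
    refine (((hasSum_piGW j).sub ((hasSum_piGW_mul_self j).mul_right a⁻¹)).add
      (hS.mul_right (Real.exp (l * (j - a)) / (l * a)))).congr_fun fun m => ?_
    have : Real.exp (l * (m - a)) = Real.exp (l * (m - j)) * Real.exp (l * (j - a)) := by
      rw [← Real.exp_add]
      congr 1
      ring
    rw [this]
    ring
  have hpos : ∀ m : ℕ, max (1 - m / a) 0 ≤ 1 - m / a + Real.exp (l * (m - a)) / (l * a) := by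
    intro m
    have h1 : 0 < Real.exp (l * (m - a)) / (l * a) := by positivity
    refine max_le (by linarith) ?_
    have h2 : (m - a) / a ≤ Real.exp (l * (m - a)) / (l * a) := by
      rw [div_le_div_iff₀ ha hla]
      nlinarith [Real.add_one_le_exp (l * (m - a))]
    have h3 : ((m : ℝ) - a) / a = m / a - 1 := by field_simp
    linarith
  calc ∑ m ∈ Finset.range N, piGW j m * max (1 - m / a) 0
      ≤ ∑ m ∈ Finset.range N, piGW j m * (1 - m / a + Real.exp (l * (m - a)) / (l * a)) :=
        Finset.sum_le_sum fun m _ => mul_le_mul_of_nonneg_left (hpos m) (piGW_nonneg j m)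
    _ ≤ 1 - j * a⁻¹ + S * (Real.exp (l * (j - a)) / (l * a)) :=
        sum_le_hasSum _ (fun m _ => mul_nonneg (piGW_nonneg j m)
          ((le_max_right _ _).trans (hpos m))) hsum
    _ ≤ _ := by
        have := mul_le_mul_of_nonneg_right hle
          (show 0 ≤ Real.exp (l * (j - a)) / (l * a) by positivity)
        rw [← div_eq_mul_inv, mul_div_assoc]
        linarith

end Tail

lemma piGW_succ_mul {j : ℕ} (hj : 1 ≤ j) (m : ℕ) :
    piGW j (m + 1) * (2 * (m + 1)) = piGW j m * (j + m) := by
  obtain ⟨i, rfl⟩ := Nat.exists_eq_add_of_le' hj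
  rw [piGW_succ_left, piGW_succ_left]
  have h1 : ((m + 1 + i).choose i : ℝ) * (m + 1 : ℕ) =
      ((m + i).choose i : ℝ) * (i + 1 + m : ℕ) := by
    have h2 := Nat.add_one_mul_choose_eq (m + i) m
    rw [show m + 1 + i = m + i + 1 by ring,
      ← Nat.choose_symm_of_eq_add (show m + i + 1 = (m + 1) + i by ring),
      ← Nat.choose_symm_of_eq_add (show m + i = m + i by rfl)]
    have h3 : (m + i).choose m * (i + 1 + m) = (m + i + 1).choose (m + 1) * (m + 1) := by
      rw [← h2]
      ring
    exact_mod_cast h3.symm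
  push_cast at h1 ⊢
  calc _ = (2 ^ (i + 1))⁻¹ * (1 / 2 : ℝ) ^ m *
        (((m + 1 + i).choose i : ℝ) * (m + 1)) := by ring
    _ = _ := by rw [h1]; ring

/-- Near the diagonal the kernel is locally almost constant, so that a single value is small
compared with the tail. -/
lemma piGW_le_tail {h j : ℕ} {D : ℝ} (hD1 : 1 ≤ D) (hD2 : 8 * D ≤ h) (hD3 : (h : ℝ) ≤ D ^ 2)
    (hj : 1 ≤ j) (hjh : j ≤ h) (hjD : (h : ℝ) / 2 - D ≤ j) :
    piGW j (h - j) ≤ 32 * (D / h) * (1 - ∑ m ∈ Finset.range (h - j), piGW j m) := by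
  have hD0 : 0 < D := by linarith
  have hh0 : (0 : ℝ) < h := by linarith
  set L : ℕ := ⌊(h : ℝ) / (8 * D)⌋₊ with hL
  have hL1 : (L : ℝ) ≤ h / (8 * D) := Nat.floor_le (by positivity)
  have hL2 : (h : ℝ) / (16 * D) ≤ L := by
    have h1 := Nat.lt_floor_add_one ((h : ℝ) / (8 * D))
    rw [← hL] at h1
    have h2 : 1 ≤ L := by
      rw [hL, Nat.one_le_floor_iff, one_le_div (by positivity)]
      exact hD2
    have h3 : (1 : ℝ) ≤ L := by exact_mod_cast h2
    have h4 : (h : ℝ) / (16 * D) = h / (8 * D) / 2 := by field_simp; norm_num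
    linarith
  have hLD : (L : ℝ) ≤ D := by
    refine hL1.trans ?_
    rw [div_le_iff₀ (by positivity)]
    nlinarith
  set ρ : ℝ := 1 - 4 * D / h with hρ
  have hq : 4 * D / h ≤ 1 / 2 := by
    rw [div_le_iff₀ hh0]
    linarith
  have hq0 : 0 < 4 * D / h := by positivity
  have hρ0 : 0 ≤ ρ := by rw [hρ]; linarith
  have hρ1 : ρ ≤ 1 := by rw [hρ]; linarith
  have hsub : ((h - j : ℕ) : ℝ) = h - j := Nat.cast_sub hjh
  have hdecay : ∀ i ≤ L, piGW j (h - j) * ρ ^ i ≤ piGW j (h - j + i) := by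
    intro i hi
    induction i with
    | zero => simp
    | succ i ih =>
      have ih := ih (by omega)
      have hiL : (i : ℝ) + 1 ≤ L := by exact_mod_cast hi
      have hrec := piGW_succ_mul hj (h - j + i)
      push_cast at hrec
      rw [hsub] at hrec
      have hpos : (0 : ℝ) < 2 * (h - j + i + 1) := by
        have : (j : ℝ) ≤ h := by exact_mod_cast hjh
        have : (0 : ℝ) ≤ i := by positivity
        linarith
      have hfac : ρ * (2 * (h - j + i + 1)) ≤ j + (h - j + i) := by
        have h1 : ρ * (2 * (h - j + i + 1)) ≤ ρ * (h + 2 * D + 2 * i + 2) :=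
          mul_le_mul_of_nonneg_left (by linarith) hρ0
        have h2 : ρ * (h + 2 * D + 2 * i + 2) =
            h + 2 * D + 2 * i + 2 - 4 * D - 4 * D / h * (2 * D + 2 * i + 2) := by
          rw [hρ]
          field_simp
          ring
        have h3 : 0 ≤ 4 * D / h * (2 * D + 2 * i + 2) := by positivity
        linarith
      have h4 : piGW j (h - j + i) * ρ ≤ piGW j (h - j + (i + 1)) := by
        refine le_of_mul_le_mul_right ?_ hpos
        calc piGW j (h - j + i) * ρ * (2 * (h - j + i + 1))
            = piGW j (h - j + i) * (ρ * (2 * (h - j + i + 1))) := by ring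
          _ ≤ piGW j (h - j + i) * (j + (h - j + i)) :=
            mul_le_mul_of_nonneg_left hfac (piGW_nonneg _ _)
          _ = _ := hrec.symm
      calc piGW j (h - j) * ρ ^ (i + 1) = piGW j (h - j) * ρ ^ i * ρ := by ring
        _ ≤ piGW j (h - j + i) * ρ := mul_le_mul_of_nonneg_right ih hρ0
        _ ≤ _ := h4
  have hhalf : (1 : ℝ) / 2 ≤ ρ ^ L := by
    have h1 := one_add_mul_le_pow (a := -(4 * D / h)) (by linarith) L
    have h2 : (L : ℝ) * (4 * D / h) ≤ 1 / 2 := by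
      calc (L : ℝ) * (4 * D / h) ≤ h / (8 * D) * (4 * D / h) :=
            mul_le_mul_of_nonneg_right hL1 hq0.le
        _ = 1 / 2 := by field_simp; norm_num
    have h3 : 1 + -(4 * D / h) = ρ := by rw [hρ]; ring
    rw [h3] at h1
    linarith
  have hlow : (L : ℝ) * (piGW j (h - j) / 2) ≤ ∑ i ∈ Finset.range L, piGW j (h - j + i) := by
    have hc : (L : ℝ) * (piGW j (h - j) / 2) = ∑ _i ∈ Finset.range L, piGW j (h - j) / 2 := by
      simp
    rw [hc]
    refine Finset.sum_le_sum fun i hi => ?_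
    have hi' := (Finset.mem_range.mp hi).le
    refine le_trans ?_ (hdecay i hi')
    have h1 : ρ ^ L ≤ ρ ^ i := pow_le_pow_of_le_one hρ0 hρ1 hi'
    have := mul_le_mul_of_nonneg_left (hhalf.trans h1) (piGW_nonneg j (h - j))
    linarith
  have htot := sum_piGW_le_one j (Finset.range (h - j + L))
  rw [Finset.sum_range_add] at htot
  have h5 : (h : ℝ) / (16 * D) * (piGW j (h - j) / 2) ≤
      1 - ∑ m ∈ Finset.range (h - j), piGW j m := by
    have := mul_le_mul_of_nonneg_right hL2
      (show 0 ≤ piGW j (h - j) / 2 from div_nonneg (piGW_nonneg _ _) two_pos.le)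
    linarith
  have h6 := mul_le_mul_of_nonneg_left h5 (show 0 ≤ 32 * (D / h) by positivity)
  refine le_trans (le_of_eq ?_) h6
  field_simp
  ring

/-! ### Supersolutions -/

lemma hitBound_succ {h p : ℕ} (hh : 2 ≤ h) {V : ℕ → ℝ} {A B : ℝ} (hA : 0 ≤ A) (hB : 0 ≤ B)
    (hV0 : ∀ k, 0 ≤ V k) (hV : HitBound h p V)
    (hstep : ∀ j, 1 ≤ j → j ≤ h → piGW j (h - j) * V (h - j) ≤
      A * (1 - ∑ m ∈ Finset.range (h - j), piGW j m) + B) :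
    HitBound h (p + 1) fun k => A + B * driftFun h k := by
  refine hitBound_of_supersolution hV0
    (fun k => add_nonneg hA (mul_nonneg hB (driftFun_nonneg hh k))) ?_ (by omega) ?_
  · intro q hq
    obtain rfl : p = q := by omega
    exact hV
  · intro j hjh
    rcases Nat.eq_zero_or_pos j with rfl | hj
    · have h1 : h ≠ 0 := by omega
      have h2 : 0 < h := by omega
      simp [piGW_zero_left, h1, h2]
    · have h1 := hstep j hj hjh
      have h2 : ∑ m ∈ Finset.range (h - j), piGW j m * (A + B * driftFun h m) =
          A * ∑ m ∈ Finset.range (h - j), piGW j m +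
            B * ∑ m ∈ Finset.range (h - j), piGW j m * driftFun h m := by
        rw [Finset.mul_sum, Finset.mul_sum, ← Finset.sum_add_distrib]
        exact Finset.sum_congr rfl fun m _ => by ring
      have h3 := mul_le_mul_of_nonneg_left (sum_piGW_mul_driftFun_le hh hj hjh (h - j)) hB
      rw [h2]
      linarith

/-- An upper bound for the probability that the chain started below `h` jumps by `D / 2`. -/
noncomputable def jumpErr (h : ℕ) (l D : ℝ) : ℝ := Real.exp 8 * h * Real.exp (-(l * D / 2))

/-- The bound for the probability of staying below `h`: a truncated linear function plus a
correction. -/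
noncomputable def stayBound (h : ℕ) (l D : ℝ) (k : ℕ) : ℝ :=
  max (1 - k / ((h : ℝ) / 2 + D)) 0 + jumpErr h l D * driftFun h k

section Supersolution

variable {h : ℕ} {l D : ℝ} (hh : 8 ≤ h) (hl : 0 < l) (hlh : l ^ 2 * h = 1) (hD1 : 1 ≤ D)

lemma jumpErr_nonneg (h : ℕ) (l D : ℝ) : 0 ≤ jumpErr h l D := by
  unfold jumpErr
  positivity

include hh in
lemma stayBound_nonneg (k : ℕ) : 0 ≤ stayBound h l D k :=
  add_nonneg (le_max_right _ _)
    (mul_nonneg (jumpErr_nonneg h l D) (driftFun_nonneg (by omega) k))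

include hh in
lemma exp_le_jumpErr {x : ℝ} (hx : x ≤ -(l * D / 2)) :
    Real.exp 8 * Real.exp x ≤ jumpErr h l D := by
  have h0 : (8 : ℝ) ≤ h := by exact_mod_cast hh
  have h1 := Real.exp_le_exp.mpr hx
  have h2 : Real.exp 8 * Real.exp x ≤ Real.exp 8 * Real.exp (-(l * D / 2)) :=
    mul_le_mul_of_nonneg_left h1 (Real.exp_pos _).le
  have h3 : 0 < Real.exp 8 * Real.exp (-(l * D / 2)) := by positivity
  unfold jumpErr
  nlinarith

include hh hl hlh hD1

lemma piGW_le_jumpErr {j : ℕ} (hjh : j ≤ h) (hj : D ≤ |(j : ℝ) - h / 2|) :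
    piGW j (h - j) ≤ jumpErr h l D := by
  have hsub : ((h - j : ℕ) : ℝ) = h - j := Nat.cast_sub hjh
  have hlD : 0 < l * D := by positivity
  rcases le_abs'.mp hj with h1 | h1
  · refine (piGW_le_exp hh hlh hjh (h - j)).trans (exp_le_jumpErr hh ?_)
    rw [hsub]
    nlinarith
  · refine (piGW_le_exp (l := -l) hh (by rw [neg_sq]; exact hlh) hjh (h - j)).trans
      (exp_le_jumpErr hh ?_)
    rw [hsub]
    nlinarith

lemma hitBound_stayBound : HitBound h 0 (stayBound h l D) := by
  have h0 : (8 : ℝ) ≤ h := by exact_mod_cast hh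
  have hlD : 0 < l * D := by positivity
  set a : ℝ := (h : ℝ) / 2 + D with ha
  have ha0 : 0 < a := by linarith
  set δ := jumpErr h l D with hδ
  have hδ0 : 0 ≤ δ := jumpErr_nonneg h l D
  refine hitBound_of_supersolution (V := fun _ => 0) (fun _ => le_rfl)
    (stayBound_nonneg hh) (by omega) ?_ ?_
  · intro _
    simp [stayBound, driftFun]
  · intro j hjh
    rw [mul_zero, add_zero]
    rcases Nat.eq_zero_or_pos j with rfl | hj
    · have h2 : 0 < h := by omega
      simp [piGW_zero_left, h2]
    have hjr : (j : ℝ) ≤ h := by exact_mod_cast hjh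
    have hsplit : ∑ m ∈ Finset.range (h - j), piGW j m * stayBound h l D m =
        ∑ m ∈ Finset.range (h - j), piGW j m * max (1 - m / a) 0 +
          δ * ∑ m ∈ Finset.range (h - j), piGW j m * driftFun h m := by
      rw [Finset.mul_sum, ← Finset.sum_add_distrib]
      exact Finset.sum_congr rfl fun m _ => by rw [stayBound]; ring
    have hdrift := mul_le_mul_of_nonneg_left
      (sum_piGW_mul_driftFun_le (show 2 ≤ h by omega) hj hjh (h - j)) hδ0
    have hmain : ∑ m ∈ Finset.range (h - j), piGW j m * max (1 - m / a) 0 ≤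
        max (1 - j / a) 0 + δ := by
      rcases le_total (j : ℝ) (h / 2 + D / 2) with hcase | hcase
      · have h1 := sum_piGW_mul_posPart_le hh hlh hjh hl ha0 (h - j)
        have hl1 : 1 ≤ h * (l * a) := by
          have h2 : l ≤ 1 := by nlinarith
          have h3 : (1 : ℝ) ≤ l * h := by nlinarith
          have h4 : 1 ≤ a := by linarith
          nlinarith
        have h2 : Real.exp 8 * Real.exp (l * (j - a)) / (l * a) ≤ δ := by
          rw [div_le_iff₀ (by positivity), hδ, jumpErr]
          have h3 : Real.exp (l * (j - a)) ≤ Real.exp (-(l * D / 2)) := by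
            apply Real.exp_le_exp.mpr
            nlinarith
          have h4 : 0 < Real.exp 8 * Real.exp (-(l * D / 2)) := by positivity
          calc Real.exp 8 * Real.exp (l * (j - a))
              ≤ Real.exp 8 * Real.exp (-(l * D / 2)) :=
                mul_le_mul_of_nonneg_left h3 (Real.exp_pos _).le
            _ ≤ Real.exp 8 * Real.exp (-(l * D / 2)) * (h * (l * a)) :=
                le_mul_of_one_le_right h4.le hl1
            _ = _ := by ring
        linarith [le_max_left (1 - (j : ℝ) / a) 0]
      · have h1 := sum_piGW_mul_exp_le (l := -l) hh (by rw [neg_sq]; exact hlh) hjh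
          (Finset.range (h - j)) (h - j)
        have h2 : Real.exp 8 * Real.exp (-l * (j - (h - j))) ≤ δ := by
          apply exp_le_jumpErr hh
          nlinarith
        have h3 : ∑ m ∈ Finset.range (h - j), piGW j m * max (1 - m / a) 0 ≤
            ∑ m ∈ Finset.range (h - j), piGW j m * Real.exp (-l * (m - (h - j))) := by
          refine Finset.sum_le_sum fun m hm => mul_le_mul_of_nonneg_left ?_ (piGW_nonneg j m)
          have hm' : m + j < h := by
            have := Finset.mem_range.mp hm
            omega
          have hm'' : (m : ℝ) + j < h := by exact_mod_cast hm'
          have h4 : max (1 - (m : ℝ) / a) 0 ≤ 1 := by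
            have : 0 ≤ (m : ℝ) / a := by positivity
            exact max_le (by linarith) zero_le_one
          refine h4.trans (Real.one_le_exp ?_)
          nlinarith
        linarith [le_max_right (1 - (j : ℝ) / a) 0]
    rw [hsplit, stayBound]
    linarith

variable (hD2 : 8 * D ≤ h) (hD3 : (h : ℝ) ≤ D ^ 2)
  (hδ : 6 * jumpErr h l D * (h : ℝ) ^ 3 ≤ 1)
include hD2 hδ

omit hl hlh hD1 hD2 in
lemma jumpErr_mul_driftFun_le (k : ℕ) : 2 * (jumpErr h l D * driftFun h k) ≤ 1 / h := by
  have h0 : (8 : ℝ) ≤ h := by exact_mod_cast hh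
  have h1 := mul_le_mul_of_nonneg_left (driftFun_le (show 2 ≤ h by omega) k)
    (jumpErr_nonneg h l D)
  rw [le_div_iff₀ (by linarith)]
  nlinarith

omit hl hlh hD2 in
lemma stayBound_le {k : ℕ} (hk : (h : ℝ) / 2 - D ≤ k) : stayBound h l D k ≤ 5 * (D / h) := by
  have h0 : (8 : ℝ) ≤ h := by exact_mod_cast hh
  have h1 := jumpErr_mul_driftFun_le hh hδ k
  have h2 : 1 / (h : ℝ) ≤ D / h := div_le_div_of_nonneg_right hD1 (by linarith)
  have h3 : max (1 - (k : ℝ) / ((h : ℝ) / 2 + D)) 0 ≤ 4 * (D / h) := by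
    refine max_le ?_ (by positivity)
    have h4 : 1 - (k : ℝ) / ((h : ℝ) / 2 + D) = ((h : ℝ) / 2 + D - k) / (h / 2 + D) := by
      field_simp
    rw [h4, ← mul_div_assoc, div_le_div_iff₀ (by linarith) (by linarith)]
    nlinarith
  have h5 : 0 ≤ jumpErr h l D * driftFun h k :=
    mul_nonneg (jumpErr_nonneg h l D) (driftFun_nonneg (by omega) k)
  unfold stayBound
  linarith

omit hl hlh hD2 in
lemma stayBound_le_two (k : ℕ) : stayBound h l D k ≤ 2 := by
  have h0 : (8 : ℝ) ≤ h := by exact_mod_cast hh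
  have h1 := jumpErr_mul_driftFun_le hh hδ k
  have h2 : 1 / (h : ℝ) ≤ 1 := by
    rw [div_le_one (by linarith)]
    linarith
  have h3 : 0 ≤ (k : ℝ) / ((h : ℝ) / 2 + D) := by positivity
  have h4 : max (1 - (k : ℝ) / ((h : ℝ) / 2 + D)) 0 ≤ 1 := max_le (by linarith) zero_le_one
  have h5 : 0 ≤ jumpErr h l D * driftFun h k :=
    mul_nonneg (jumpErr_nonneg h l D) (driftFun_nonneg (by omega) k)
  unfold stayBound
  linarith

include hD3

omit hδ in
lemma piGW_le_tail_add_jumpErr {j : ℕ} (hj : 1 ≤ j) (hjh : j ≤ h) :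
    piGW j (h - j) ≤
      32 * (D / h) * (1 - ∑ m ∈ Finset.range (h - j), piGW j m) + jumpErr h l D := by
  rcases le_total ((h : ℝ) / 2 - D) j with h1 | h1
  · linarith [piGW_le_tail hD1 hD2 hD3 hj hjh h1, jumpErr_nonneg h l D]
  · have h2 := piGW_le_jumpErr hh hl hlh hD1 hjh
      (le_trans (by linarith) (neg_le_abs ((j : ℝ) - h / 2)))
    have h3 : 0 ≤ 32 * (D / h) * (1 - ∑ m ∈ Finset.range (h - j), piGW j m) :=
      mul_nonneg (by positivity) (by linarith [sum_piGW_le_one j (Finset.range (h - j))])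
    linarith

lemma hitBound_one : HitBound h 1 fun _ => 161 * (D / h) ^ 2 := by
  have h0 : (8 : ℝ) ≤ h := by exact_mod_cast hh
  have hη : 0 ≤ D / (h : ℝ) := by positivity
  have hη2 : 1 / (h : ℝ) ≤ (D / h) ^ 2 := by
    rw [div_pow, div_le_div_iff₀ (by linarith) (by positivity)]
    nlinarith
  have hδ0 := jumpErr_nonneg h l D
  refine (hitBound_succ (A := 160 * (D / h) ^ 2) (B := 2 * jumpErr h l D)
    (show 2 ≤ h by omega) (by positivity) (by linarith) (stayBound_nonneg hh)
    (hitBound_stayBound hh hl hlh hD1) ?_).mono ?_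
  · intro j hj hjh
    have htail : 0 ≤ 1 - ∑ m ∈ Finset.range (h - j), piGW j m := by
      linarith [sum_piGW_le_one j (Finset.range (h - j))]
    have hsub : ((h - j : ℕ) : ℝ) = h - j := Nat.cast_sub hjh
    have htwo := stayBound_le_two hh hD1 hδ (h - j)
    have hstay0 := stayBound_nonneg (l := l) (D := D) hh (h - j)
    rcases le_total D |(j : ℝ) - h / 2| with h1 | h1
    · have h2 := mul_le_mul (piGW_le_jumpErr hh hl hlh hD1 hjh h1) htwo hstay0 hδ0
      have h3 : 0 ≤ 160 * (D / h) ^ 2 * (1 - ∑ m ∈ Finset.range (h - j), piGW j m) := by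
        positivity
      linarith
    · have h2 : stayBound h l D (h - j) ≤ 5 * (D / h) := by
        apply stayBound_le hh hD1 hδ
        rw [hsub]
        linarith [(abs_le.mp h1).2]
      have h3 := mul_le_mul_of_nonneg_right
        (piGW_le_tail_add_jumpErr hh hl hlh hD1 hD2 hD3 hj hjh) hstay0
      have h4 := mul_le_mul_of_nonneg_left h2
        (show 0 ≤ 32 * (D / h) * (1 - ∑ m ∈ Finset.range (h - j), piGW j m) by positivity)
      have h5 := mul_le_mul_of_nonneg_left htwo hδ0
      linarith
  · intro k
    have := jumpErr_mul_driftFun_le hh hδ k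
    linarith

lemma hitBound_succ_const (p : ℕ) :
    HitBound h (p + 1) fun _ => 161 * (D / h) ^ 2 * (33 * (D / h)) ^ p := by
  have h0 : (8 : ℝ) ≤ h := by exact_mod_cast hh
  have hη : 0 ≤ D / (h : ℝ) := by positivity
  have hδ0 := jumpErr_nonneg h l D
  induction p with
  | zero =>
    simpa using hitBound_one hh hl hlh hD1 hD2 hD3 hδ
  | succ p ih =>
    set v : ℝ := 161 * (D / h) ^ 2 * (33 * (D / h)) ^ p with hv
    have hv0 : 0 ≤ v := by positivity
    refine (hitBound_succ (A := 32 * (D / h) * v) (B := jumpErr h l D * v)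
      (show 2 ≤ h by omega) (by positivity) (by positivity) (fun _ => hv0) ih ?_).mono ?_
    · intro j hj hjh
      have := mul_le_mul_of_nonneg_right
        (piGW_le_tail_add_jumpErr hh hl hlh hD1 hD2 hD3 hj hjh) hv0
      linarith
    · intro k
      have h1 := jumpErr_mul_driftFun_le hh hδ k
      have h2 : 1 / (h : ℝ) ≤ D / h := div_le_div_of_nonneg_right hD1 (by linarith)
      have h3 : 0 ≤ jumpErr h l D * driftFun h k :=
        mul_nonneg hδ0 (driftFun_nonneg (by omega) k)
      have h4 := mul_le_mul_of_nonneg_right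
        (show jumpErr h l D * driftFun h k ≤ D / h by linarith) hv0
      have h5 : 161 * (D / h) ^ 2 * (33 * (D / h)) ^ (p + 1) = 33 * (D / h) * v := by
        rw [hv]
        ring
      rw [h5]
      linarith

end Supersolution

/-! ### The scale `h ^ (1 / 2 + ε)` -/

lemma eventually_scale {ε : ℝ} (hε : 0 < ε) (hε2 : ε < 1 / 2) :
    ∀ᶠ h : ℕ in Filter.atTop, 8 ≤ h ∧ 8 * (h : ℝ) ^ ((1 : ℝ) / 2 + ε) ≤ h ∧
      6 * jumpErr h ((h : ℝ) ^ (-(1 : ℝ) / 2)) ((h : ℝ) ^ ((1 : ℝ) / 2 + ε)) * (h : ℝ) ^ 3 ≤ 1 := by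
  have hcast := tendsto_natCast_atTop_atTop (R := ℝ)
  have h1 : ∀ᶠ h : ℕ in Filter.atTop, (8 : ℝ) ≤ (h : ℝ) ^ ((1 : ℝ) / 2 - ε) :=
    ((tendsto_rpow_atTop (by linarith)).comp hcast).eventually_ge_atTop 8
  have h2 : Filter.Tendsto (fun x : ℝ => 6 * Real.exp 8 *
      (x ^ (4 / ε) * Real.exp (-(1 / 2) * x))) Filter.atTop (nhds (6 * Real.exp 8 * 0)) :=
    (tendsto_rpow_mul_exp_neg_mul_atTop_nhds_zero (4 / ε) (1 / 2) (by norm_num)).const_mul _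
  rw [mul_zero] at h2
  have h3 := (h2.comp ((tendsto_rpow_atTop hε).comp hcast)).eventually_le_const
    (show (0 : ℝ) < 1 by norm_num)
  filter_upwards [Filter.eventually_ge_atTop 8, h1, h3] with h hh h1 h3
  have h0 : (0 : ℝ) < h := by
    have : (8 : ℝ) ≤ h := by exact_mod_cast hh
    linarith
  refine ⟨hh, ?_, ?_⟩
  · calc 8 * (h : ℝ) ^ ((1 : ℝ) / 2 + ε)
        ≤ (h : ℝ) ^ ((1 : ℝ) / 2 - ε) * (h : ℝ) ^ ((1 : ℝ) / 2 + ε) :=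
          mul_le_mul_of_nonneg_right h1 (by positivity)
      _ = h := by
          rw [← Real.rpow_add h0]
          norm_num
  · have e1 : (h : ℝ) ^ (-(1 : ℝ) / 2) * (h : ℝ) ^ ((1 : ℝ) / 2 + ε) = (h : ℝ) ^ ε := by
      rw [← Real.rpow_add h0]
      congr 1
      ring
    have e2 : ((h : ℝ) ^ ε) ^ (4 / ε) = (h : ℝ) ^ 4 := by
      rw [← Real.rpow_mul h0.le, mul_div_cancel₀ _ hε.ne']
      exact_mod_cast Real.rpow_natCast (h : ℝ) 4
    have e3 : -(1 / 2) * (h : ℝ) ^ ε = -((h : ℝ) ^ ε / 2) := by ring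
    simp only [Function.comp_apply, e2, e3] at h3
    rw [jumpErr, e1]
    linarith

/-- For every ε > 0 there exists a finite constant C such that for all integers
h ≥ 1, k ≥ 0 and p ≥ 0, if either k ∈ [(h − h^{1/2+ε})/2, (h + h^{1/2+ε})/2] or
p ≥ 1, and the chain Y starts at k, then P(A_{h,p}) ≤ (C·h^{−1/2+ε})^{p+1}. -/
theorem stmt_3 :
    ∀ ε : ℝ, 0 < ε → ∃ C : ℝ,
      ∀ (h k p : ℕ), 1 ≤ h →
        ((((h : ℝ) - (h : ℝ) ^ ((1 : ℝ) / 2 + ε)) / 2 ≤ (k : ℝ) ∧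
            (k : ℝ) ≤ ((h : ℝ) + (h : ℝ) ^ ((1 : ℝ) / 2 + ε)) / 2) ∨ 1 ≤ p) →
        ∀ (Ω : Type) (_ : MeasurableSpace Ω) (P : Measure Ω) (Y : ℕ → Ω → ℕ),
          IsProbabilityMeasure P → IsMarkovChainFrom P Y piGW k →
          P (eventA Y h p) ≤
            ENNReal.ofReal ((C * (h : ℝ) ^ (-(1 : ℝ) / 2 + ε)) ^ (p + 1)) := by
  intro ε hε
  have htriv : ∀ (h p : ℕ) (C : ℝ), 1 ≤ C * (h : ℝ) ^ (-(1 : ℝ) / 2 + ε) →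
      ∀ (Ω : Type) (_ : MeasurableSpace Ω) (P : Measure Ω) (Y : ℕ → Ω → ℕ),
        IsProbabilityMeasure P → P (eventA Y h p) ≤
          ENNReal.ofReal ((C * (h : ℝ) ^ (-(1 : ℝ) / 2 + ε)) ^ (p + 1)) := by
    intro h p C hC Ω _ P Y hP
    refine prob_le_one.trans ?_
    rw [← ENNReal.ofReal_one]
    exact ENNReal.ofReal_le_ofReal (one_le_pow₀ hC)
  rcases le_or_gt (1 / 2) ε with hε2 | hε2
  · refine ⟨1, fun h k p hh _ Ω _ P Y hP _ => htriv h p 1 ?_ Ω _ P Y hP⟩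
    rw [one_mul]
    exact Real.one_le_rpow (by exact_mod_cast hh) (by linarith)
  obtain ⟨N, hN⟩ := Filter.eventually_atTop.mp (eventually_scale hε hε2)
  refine ⟨161 + N, fun h k p hh hk Ω _ P Y hP hY => ?_⟩
  have hh1 : (1 : ℝ) ≤ h := by exact_mod_cast hh
  have hh0 : (0 : ℝ) < h := by linarith
  have hN0 : (0 : ℝ) ≤ N := Nat.cast_nonneg N
  rcases lt_or_ge h N with hsmall | hlarge
  · refine htriv h p _ ?_ Ω _ P Y hP
    have h1 : (h : ℝ) ^ (-1 : ℝ) ≤ (h : ℝ) ^ (-(1 : ℝ) / 2 + ε) :=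
      Real.rpow_le_rpow_of_exponent_le hh1 (by linarith)
    rw [Real.rpow_neg_one] at h1
    have h2 : (h : ℝ) ≤ 161 + N := by
      have : (h : ℝ) ≤ N := by exact_mod_cast hsmall.le
      linarith
    calc (1 : ℝ) = h * (h : ℝ)⁻¹ := (mul_inv_cancel₀ hh0.ne').symm
      _ ≤ _ := mul_le_mul h2 h1 (by positivity) (by positivity)
  obtain ⟨h8, hD2, hδ⟩ := hN h hlarge
  set D : ℝ := (h : ℝ) ^ ((1 : ℝ) / 2 + ε) with hD
  set l : ℝ := (h : ℝ) ^ (-(1 : ℝ) / 2) with hl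
  have hl0 : 0 < l := by positivity
  have hlh : l ^ 2 * h = 1 := by
    rw [hl, ← Real.rpow_natCast, ← Real.rpow_mul hh0.le]
    norm_num
    rw [Real.rpow_neg_one]
    exact inv_mul_cancel₀ hh0.ne'
  have hD1 : 1 ≤ D := Real.one_le_rpow hh1 (by linarith)
  have hD3 : (h : ℝ) ≤ D ^ 2 := by
    rw [hD, ← Real.rpow_natCast, ← Real.rpow_mul hh0.le]
    calc (h : ℝ) = (h : ℝ) ^ (1 : ℝ) := (Real.rpow_one _).symm
      _ ≤ _ := Real.rpow_le_rpow_of_exponent_le hh1 (by push_cast; linarith)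
  have hη : (h : ℝ) ^ (-(1 : ℝ) / 2 + ε) = D / h := by
    rw [hD, ← Real.rpow_sub_one hh0.ne']
    congr 1
    ring
  rw [hη]
  have hη0 : 0 ≤ D / (h : ℝ) := by positivity
  cases p with
  | zero =>
    have hk1 : (h : ℝ) / 2 - D ≤ k := by
      rcases hk with hk | hk
      · linarith [hk.1]
      · omega
    refine ((hitBound_stayBound h8 hl0 hlh hD1).measure_eventA_le hY).trans
      (ENNReal.ofReal_le_ofReal ?_)
    refine (stayBound_le h8 hD1 hδ hk1).trans ?_
    rw [zero_add, pow_one]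
    exact mul_le_mul_of_nonneg_right (by linarith) hη0
  | succ p =>
    refine ((hitBound_succ_const h8 hl0 hlh hD1 hD2 hD3 hδ p).measure_eventA_le hY).trans
      (ENNReal.ofReal_le_ofReal ?_)
    have h1 : 161 * (D / h) ^ 2 ≤ ((161 + N) * (D / h)) ^ 2 := by
      rw [mul_pow]
      exact mul_le_mul_of_nonneg_right (by nlinarith) (by positivity)
    have h2 : (33 * (D / h)) ^ p ≤ ((161 + N) * (D / h)) ^ p :=
      pow_le_pow_left₀ (by positivity) (mul_le_mul_of_nonneg_right (by linarith) hη0) p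
    calc 161 * (D / h) ^ 2 * (33 * (D / h)) ^ p
        ≤ ((161 + N) * (D / h)) ^ 2 * ((161 + N) * (D / h)) ^ p :=
          mul_le_mul h1 h2 (by positivity) (by positivity)
      _ = _ := by ring
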